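/- Let W be a finite Coxeter group with generating set indexed by Δ, let I ⊆ Δ and i ∉ I. Writing ℓ_Γ for the longest element of the parabolic subgroup W_Γ, and setting w = ℓ_I ℓ_{I+i} where I+i = I ∪ {i}, there exists a subset K ⊆ Δ with W_I w = w W_K; moreover K = (I ∪ {i}) \ {ι_{I+i}(i)}, where ι_{I+i} is the Dynkin involution of the sub-diagram on I ∪ {i} (i.e. conjugation by ℓ_{I+i} sends the generator s_j to s_{ι_{I+i}(j)} for j ∈ I ∪ {i}). -/

import Mathlib

namespace Module

open Polynomial.Chebyshev

/-- The product of two reflections whose pairings are both `-2 * cos (π / m)` satisfies the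
braid relation of order `m`. -/
theorem reflection_mul_reflection_pow_eq_one {V : Type*} [AddCommGroup V] [Module ℝ V]
    {x y : V} {f g : Dual ℝ V} (hf : f x = 2) (hg : g y = 2) {m : ℕ} (hm : 2 ≤ m)
    (hfy : f y = -2 * Real.cos (Real.pi / m)) (hgx : g x = -2 * Real.cos (Real.pi / m)) :
    (reflection hf * reflection hg) ^ m = 1 := by
  ext z
  rw [reflection_mul_reflection_pow_apply hf hg m z]
  rcases hm.eq_or_lt with rfl | hm
  · have h0 : Real.cos (Real.pi / (2 : ℕ)) = 0 := by simp
    rw [h0] at hfy hgx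
    norm_num [hfy, hgx]
    abel
  have hm0 : (0 : ℝ) < m := by positivity
  have hm3 : (3 : ℝ) ≤ m := by exact_mod_cast hm
  set θ : ℝ := 2 * Real.pi / m with hθ
  have hmθ : m * θ = 2 * Real.pi := by rw [hθ]; field_simp
  have ht : f y * g x - 2 = 2 * Real.cos θ := by
    have : θ = 2 * (Real.pi / m) := by rw [hθ]; ring
    rw [hfy, hgx, this, Real.cos_two_mul]
    ring
  have hsin : Real.sin θ ≠ 0 := by
    refine (Real.sin_pos_of_pos_of_lt_pi (by positivity) ?_).ne'
    nlinarith [Real.pi_pos]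
  rw [ht]
  obtain ⟨k, rfl | rfl⟩ := m.even_or_odd'
  · have hk : k * θ = Real.pi := by push_cast at hmθ; linarith
    have hS : (S ℝ ((k : ℤ) - 1)).eval (2 * Real.cos θ) = 0 := by
      refine (mul_eq_zero.mp ?_).resolve_right hsin
      rw [S_two_mul_real_cos]
      push_cast
      rw [sub_add_cancel, hk, Real.sin_pi]
    have e₁ : (((2 * k : ℕ) : ℤ) - 2) / 2 = k - 1 := by lia
    have e₂ : (((2 * k : ℕ) : ℤ) - 1) / 2 = k - 1 := by lia
    simp only [e₁, e₂, hS, zero_mul, zero_smul, add_zero]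
    simp
  · have hk : k * θ = Real.pi - θ / 2 := by push_cast at hmθ; linarith
    have hS : (S ℝ (k : ℤ)).eval (2 * Real.cos θ) +
        (S ℝ ((k : ℤ) - 1)).eval (2 * Real.cos θ) = 0 := by
      refine (mul_eq_zero.mp ?_).resolve_right hsin
      rw [add_mul, S_two_mul_real_cos, S_two_mul_real_cos]
      push_cast
      have h : ((k : ℝ) + 1) * θ = Real.pi + θ / 2 := by linarith
      rw [sub_add_cancel, h, hk, Real.sin_pi_sub, add_comm Real.pi, Real.sin_add_pi]
      ring
    have e₁ : (((2 * k + 1 : ℕ) : ℤ) - 2) / 2 = k - 1 := by lia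
    have e₂ : (((2 * k + 1 : ℕ) : ℤ) - 1) / 2 = k := by lia
    have e₃ : (((2 * k + 1 : ℕ) : ℤ) - 3) / 2 = k - 1 := by lia
    have e₄ : ((2 * k + 1 : ℕ) : ℤ) / 2 = k := by lia
    simp only [e₁, e₂, e₃, e₄, hS, mul_zero, zero_smul, add_zero]
    simp

end Module

namespace CoxeterMatrix

variable {B : Type*} (M : CoxeterMatrix B)

/-- The simple coroot `α ↦ 2 ⟨α, αᵢ⟩` of the geometric representation. -/
noncomputable def simpleCoroot (i : B) : Module.Dual ℝ (B →₀ ℝ) :=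
  Finsupp.linearCombination ℝ fun j => -2 * Real.cos (Real.pi / M i j)

theorem simpleCoroot_single (i j : B) :
    M.simpleCoroot i (Finsupp.single j 1) = -2 * Real.cos (Real.pi / M i j) := by
  simp [simpleCoroot]

theorem simpleCoroot_single_self (i : B) : M.simpleCoroot i (Finsupp.single i 1) = 2 := by
  simp [simpleCoroot_single]

theorem isLiftable_reflection :
    M.IsLiftable fun i => Module.reflection (M.simpleCoroot_single_self i) := by
  intro i j
  rcases eq_or_ne i j with rfl | hij
  · rw [M.diagonal, pow_one]
    exact inv_mul_cancel (Module.reflection (M.simpleCoroot_single_self i))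
  · rcases Nat.eq_zero_or_pos (M i j) with h0 | hpos
    · rw [h0, pow_zero]
    · refine Module.reflection_mul_reflection_pow_eq_one _ _ ?_ (M.simpleCoroot_single i j) ?_
      · have := M.off_diagonal i j hij
        lia
      · rw [M.simpleCoroot_single j i, M.symmetric]

end CoxeterMatrix

namespace CoxeterSystem

variable {B W : Type*} [Group W] {M : CoxeterMatrix B} (cs : CoxeterSystem M W)

/-! ### The geometric representation -/

/-- The geometric representation of a Coxeter group. -/
noncomputable def geometricRep : W →* ((B →₀ ℝ) ≃ₗ[ℝ] (B →₀ ℝ)) :=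
  cs.lift ⟨_, M.isLiftable_reflection⟩

theorem geometricRep_simple_apply (i : B) (v : B →₀ ℝ) :
    cs.geometricRep (cs.simple i) v = v - M.simpleCoroot i v • Finsupp.single i 1 := by
  rw [geometricRep, cs.lift_apply_simple M.isLiftable_reflection, Module.reflection_apply]

theorem geometricRep_apply_of_notMem {J : Set B} {k : B} (hk : k ∉ J) {w : W}
    (hw : w ∈ Subgroup.closure (cs.simple '' J)) (v : B →₀ ℝ) :
    cs.geometricRep w v k = v k := by
  induction hw using Subgroup.closure_induction generalizing v with
  | mem x hx =>
    obtain ⟨j, hj, rfl⟩ := hx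
    have hjk : j ≠ k := fun h => hk (h ▸ hj)
    simp [geometricRep_simple_apply, hjk]
  | one => simp
  | mul x y _ _ hx hy => rw [map_mul, LinearEquiv.mul_apply, hx, hy]
  | inv x _ hx =>
    rw [← hx, ← LinearEquiv.mul_apply, ← map_mul, mul_inv_cancel, map_one, LinearEquiv.coe_one,
      id]

theorem simple_mem_closure_iff {J : Set B} {k : B} :
    cs.simple k ∈ Subgroup.closure (cs.simple '' J) ↔ k ∈ J := by
  refine ⟨fun h => ?_, fun h => Subgroup.subset_closure ⟨k, h, rfl⟩⟩
  by_contra hk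
  have := cs.geometricRep_apply_of_notMem hk h (Finsupp.single k 1)
  rw [geometricRep_simple_apply, M.simpleCoroot_single_self] at this
  norm_num at this

theorem simple_injective : Function.Injective cs.simple := by
  intro i j h
  have : cs.simple i ∈ Subgroup.closure (cs.simple '' {j}) :=
    Subgroup.subset_closure ⟨j, rfl, h.symm⟩
  simpa using cs.simple_mem_closure_iff.mp this

/-! ### The reflection cocycle -/

open Classical in
/-- The action of a simple reflection `s` on `W × ZMod 2`: it conjugates the first component by
`s`, and flips the second one if the first one equals `s`. -/
noncomputable def signedConj (i : B) : Equiv.Perm (W × ZMod 2) :=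
  Function.Involutive.toPerm
    (fun p => (cs.simple i * p.1 * cs.simple i, p.2 + if p.1 = cs.simple i then 1 else 0)) <| by
    rintro ⟨t, ε⟩
    have h : cs.simple i * t * cs.simple i = cs.simple i ↔ t = cs.simple i := by
      rw [mul_eq_right, mul_eq_one_iff_eq_inv', cs.inv_simple]
    have h2 : (1 : ZMod 2) + 1 = 0 := by decide
    ext
    · simp [mul_assoc]
    · by_cases ht : t = cs.simple i <;> simp [ht, h, add_assoc, h2]

open Classical in
theorem signedConj_apply (i : B) (p : W × ZMod 2) : cs.signedConj i p =
    (cs.simple i * p.1 * cs.simple i, p.2 + if p.1 = cs.simple i then 1 else 0) := rfl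

open Classical in
theorem signedConj_mul_pow_apply (i j : B) (n : ℕ) (t : W) (ε : ZMod 2) :
    ((cs.signedConj i * cs.signedConj j) ^ n) (t, ε) =
      ((cs.simple i * cs.simple j) ^ n * t * ((cs.simple i * cs.simple j) ^ n)⁻¹,
        ε + ∑ k ∈ Finset.range (2 * n),
          if cs.simple j * t = (cs.simple i * cs.simple j) ^ k then 1 else 0) := by
  induction n with
  | zero => simp
  | succ n ih =>
    rw [pow_succ', Equiv.Perm.mul_apply, ih, Equiv.Perm.mul_apply, signedConj_apply,
      signedConj_apply, show 2 * (n + 1) = 2 * n + 1 + 1 by ring, Finset.sum_range_succ,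
      Finset.sum_range_succ]
    set c := cs.simple i * cs.simple j with hc
    have hcomm : cs.simple j * (c ^ n)⁻¹ = c ^ n * cs.simple j := by
      have h : SemiconjBy (cs.simple j) c⁻¹ c := by
        simp [SemiconjBy, hc, mul_assoc]
      simpa using (h.pow_right n).eq
    have hiff (u : W) : c ^ n * t * (c ^ n)⁻¹ = u ↔
        cs.simple j * t = c ^ n * (cs.simple j * u) * c ^ n := by
      rw [mul_inv_eq_iff_eq_mul, ← eq_inv_mul_iff_mul_eq, ← mul_assoc (c ^ n), ← hcomm, mul_assoc,
        mul_assoc, mul_right_inj]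
    have h₁ : c ^ n * t * (c ^ n)⁻¹ = cs.simple j ↔ cs.simple j * t = c ^ (2 * n) := by
      rw [hiff, cs.simple_mul_simple_self, mul_one, two_mul, pow_add]
    have h₂ : cs.simple j * (c ^ n * t * (c ^ n)⁻¹) * cs.simple j = cs.simple i ↔
        cs.simple j * t = c ^ (2 * n + 1) := by
      have h : cs.simple j * (c ^ n * t * (c ^ n)⁻¹) * cs.simple j = cs.simple i ↔
          c ^ n * t * (c ^ n)⁻¹ = cs.simple j * c := by
        rw [← eq_mul_inv_iff_mul_eq, cs.inv_simple, ← eq_inv_mul_iff_mul_eq, cs.inv_simple]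
      rw [h, hiff, cs.simple_mul_simple_cancel_left, ← pow_succ, ← pow_add]
      ring_nf
    simp only [h₁, h₂, Prod.mk.injEq]
    refine ⟨?_, by ring⟩
    rw [pow_succ']
    simp [hc, mul_assoc]

theorem isLiftable_signedConj : M.IsLiftable cs.signedConj := by
  classical
  intro i j
  ext1 ⟨t, ε⟩
  rw [signedConj_mul_pow_apply, cs.simple_mul_simple_pow, two_mul, Finset.sum_range_add]
  simp [pow_add, cs.simple_mul_simple_pow, CharTwo.add_self_eq_zero]

/-- The action of a Coxeter group on `W × ZMod 2` extending `CoxeterSystem.signedConj`. -/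
noncomputable def signedConjHom : W →* Equiv.Perm (W × ZMod 2) :=
  cs.lift ⟨_, cs.isLiftable_signedConj⟩

theorem signedConjHom_simple (i : B) : cs.signedConjHom (cs.simple i) = cs.signedConj i :=
  cs.lift_apply_simple cs.isLiftable_signedConj i

/-- The reflection cocycle: for a reflection `t`, it is `1` if `t` is a right inversion of `w` and
`0` otherwise. -/
noncomputable def cocycle (w t : W) : ZMod 2 := (cs.signedConjHom w (t, 0)).2

theorem signedConjHom_apply (w t : W) (ε : ZMod 2) :
    cs.signedConjHom w (t, ε) = (w * t * w⁻¹, ε + cs.cocycle w t) := by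
  induction w using cs.simple_induction_left generalizing t ε with
  | one => simp [cocycle]
  | mul_simple_left w i ih =>
    rw [cocycle, map_mul, Equiv.Perm.mul_apply, Equiv.Perm.mul_apply, ih, ih, signedConjHom_simple,
      signedConj_apply, signedConj_apply]
    simp [mul_assoc, add_assoc]

open Classical in
theorem cocycle_simple (i : B) (t : W) :
    cs.cocycle (cs.simple i) t = if t = cs.simple i then 1 else 0 := by
  simp [cocycle, signedConjHom_simple, signedConj_apply]

@[simp]
theorem cocycle_one (t : W) : cs.cocycle 1 t = 0 := by simp [cocycle]

theorem cocycle_mul (u v t : W) :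
    cs.cocycle (u * v) t = cs.cocycle v t + cs.cocycle u (v * t * v⁻¹) := by
  rw [cocycle, map_mul, Equiv.Perm.mul_apply, signedConjHom_apply, signedConjHom_apply, zero_add]

theorem mem_rightInvSeq_of_cocycle_ne_zero (ω : List B) {t : W}
    (h : cs.cocycle (cs.wordProd ω) t ≠ 0) : t ∈ cs.rightInvSeq ω := by
  induction ω with
  | nil => simp at h
  | cons i ω ih =>
    rw [wordProd_cons, cocycle_mul, cocycle_simple] at h
    rw [rightInvSeq, List.mem_cons]
    by_cases ht : cs.wordProd ω * t * (cs.wordProd ω)⁻¹ = cs.simple i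
    · left
      rw [← ht]
      group
    · right
      exact ih (by simpa [ht] using h)

theorem isRightInversion_of_cocycle_ne_zero {w t : W} (h : cs.cocycle w t ≠ 0) :
    cs.IsRightInversion w t := by
  obtain ⟨ω, hω, rfl⟩ := cs.exists_isReduced w
  exact cs.isRightInversion_of_mem_rightInvSeq hω (cs.mem_rightInvSeq_of_cocycle_ne_zero ω h)

theorem IsReflection.cocycle_self {cs : CoxeterSystem M W} {t : W} (ht : cs.IsReflection t) :
    cs.cocycle t t = 1 := by
  obtain ⟨w, i, rfl⟩ := ht
  set t := w * cs.simple i * w⁻¹ with ht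
  have hconj : w⁻¹ * t * w⁻¹⁻¹ = cs.simple i := by rw [ht]; group
  have h : cs.cocycle (w * w⁻¹) t = 0 := by simp
  rw [cocycle_mul, hconj] at h
  calc
    cs.cocycle t t = cs.cocycle (w * cs.simple i * w⁻¹) t := by rw [← ht]
    _ = cs.cocycle w⁻¹ t + (1 + cs.cocycle w (cs.simple i)) := by
      rw [cocycle_mul, hconj, cocycle_mul, cocycle_simple, mul_inv_cancel_right, if_pos rfl]
    _ = 1 := by rw [add_left_comm, h, add_zero]

theorem IsReflection.length_lt_of_cocycle_eq_zero {cs : CoxeterSystem M W} {w t : W}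
    (ht : cs.IsReflection t) (h : cs.cocycle w t = 0) : cs.length w < cs.length (w * t) := by
  have h1 : cs.cocycle (w * t) t ≠ 0 := by
    rw [cocycle_mul, ht.cocycle_self, mul_inv_cancel_right, h]
    decide
  have := (cs.isRightInversion_of_cocycle_ne_zero h1).2
  rwa [mul_assoc, ht.mul_self, mul_one] at this

theorem mem_closure_of_cocycle_ne_zero {J : Set B} {w t : W}
    (hw : w ∈ Subgroup.closure (cs.simple '' J)) (h : cs.cocycle w t ≠ 0) :
    t ∈ Subgroup.closure (cs.simple '' J) := by
  classical
  induction hw using Subgroup.closure_induction generalizing t with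
  | mem x hx =>
    obtain ⟨j, hj, rfl⟩ := hx
    rw [cocycle_simple] at h
    have ht : t = cs.simple j := by
      by_contra ht
      simp [ht] at h
    exact ht ▸ Subgroup.subset_closure ⟨j, hj, rfl⟩
  | one => simp at h
  | mul x y hx hy ihx ihy =>
    by_cases hyt : cs.cocycle y t = 0
    · rw [cocycle_mul, hyt, zero_add] at h
      have := ihx h
      rwa [Subgroup.mul_mem_cancel_right _ (inv_mem hy), Subgroup.mul_mem_cancel_left _ hy] at this
    · exact ihy hyt
  | inv x hx ih =>
    have h1 : cs.cocycle (x * x⁻¹) t = 0 := by simp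
    rw [cocycle_mul] at h1
    have := ih (t := x⁻¹ * t * x⁻¹⁻¹) fun h0 => h (by rwa [h0, add_zero] at h1)
    rwa [Subgroup.mul_mem_cancel_right _ (inv_mem (inv_mem hx)),
      Subgroup.mul_mem_cancel_left _ (inv_mem hx)] at this

/-- The longest element of a standard parabolic subgroup is an involution. -/
theorem mul_self_eq_one_of_forall_length_le {J : Set B} {w : W}
    (hw : w ∈ Subgroup.closure (cs.simple '' J))
    (hmax : ∀ v ∈ Subgroup.closure (cs.simple '' J), cs.length v ≤ cs.length w) :
    w * w = 1 := by
  have key {t : W} (ht : cs.IsReflection t) (htJ : t ∈ Subgroup.closure (cs.simple '' J)) :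
      cs.cocycle w t = 1 := by
    by_contra h
    have h0 : cs.cocycle w t = 0 := by
      generalize cs.cocycle w t = a at h
      revert a
      decide
    exact (ht.length_lt_of_cocycle_eq_zero h0).not_ge (hmax _ (mul_mem hw htJ))
  by_contra hne
  obtain ⟨i, hi⟩ := cs.exists_rightDescent_of_ne_one hne
  have hs := cs.isReflection_simple i
  refine (hs.length_lt_of_cocycle_eq_zero (w := w * w) ?_).not_gt hi
  rw [cocycle_mul]
  by_cases hiJ : cs.simple i ∈ Subgroup.closure (cs.simple '' J)
  · rw [key hs hiJ, key (hs.conj w) (mul_mem (mul_mem hw hiJ) (inv_mem hw))]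
    decide
  · have h1 : cs.cocycle w (cs.simple i) = 0 := by
      by_contra h
      exact hiJ (cs.mem_closure_of_cocycle_ne_zero hw h)
    have h2 : cs.cocycle w (w * cs.simple i * w⁻¹) = 0 := by
      by_contra h
      have := cs.mem_closure_of_cocycle_ne_zero hw h
      rw [Subgroup.mul_mem_cancel_right _ (inv_mem hw), Subgroup.mul_mem_cancel_left _ hw] at this
      exact hiJ this
    rw [h1, h2, add_zero]

end CoxeterSystem


/-!
STATEMENT 6: Let `W` be a finite Coxeter group with simple generators `{sⱼ : j ∈ Δ}`,
let `I ⊆ Δ` and `i ∉ I`.  Writing `ℓ_Γ` for the longest element of the standard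
parabolic subgroup `W_Γ = ⟨sⱼ : j ∈ Γ⟩`, and setting `w = ℓ_I ℓ_{I+i}` where
`I+i = I ∪ {i}`, there exists a subset `K ⊆ Δ` with `W_I w = w W_K`; moreover
`K = (I ∪ {i}) \ {ι_{I+i}(i)}`, where `ι_{I+i}` is the Dynkin involution of the
sub-diagram on `I ∪ {i}`, i.e. conjugation by `ℓ_{I+i}` sends the generator `sⱼ` to
`s_{ι_{I+i}(j)}` for `j ∈ I ∪ {i}`.

Cosets are formalised as images: `W_I w = {a * w | a ∈ W_I}` and
`w W_K = {w * b | b ∈ W_K}`.  The longest elements are characterised as elements of the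
parabolic subgroups of maximal Coxeter length.
-/
theorem stmt6 {Δ W : Type*} [Group W] [Finite W] {M : CoxeterMatrix Δ}
    (cs : CoxeterSystem M W)
    (I : Set Δ) (i : Δ) (hi : i ∉ I)
    (ℓI ℓIi : W)
    -- ℓ_I is the longest element of W_I
    (hℓImem : ℓI ∈ Subgroup.closure (cs.simple '' I))
    (hℓImax : ∀ v ∈ Subgroup.closure (cs.simple '' I), cs.length v ≤ cs.length ℓI)
    -- ℓ_{I+i} is the longest element of W_{I∪{i}}
    (hℓIimem : ℓIi ∈ Subgroup.closure (cs.simple '' (I ∪ {i})))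
    (hℓIimax : ∀ v ∈ Subgroup.closure (cs.simple '' (I ∪ {i})), cs.length v ≤ cs.length ℓIi)
    -- the Dynkin involution ι_{I+i}: conjugation by ℓ_{I+i} permutes the generators of W_{I∪{i}}
    (ι : Δ → Δ)
    (hι : ∀ j ∈ I ∪ {i}, ℓIi * cs.simple j * ℓIi⁻¹ = cs.simple (ι j)) :
    ∃ K : Set Δ, K = (I ∪ {i}) \ {ι i} ∧
      (fun a => a * (ℓI * ℓIi)) '' (Subgroup.closure (cs.simple '' I) : Set W)
        = (fun b => (ℓI * ℓIi) * b) '' (Subgroup.closure (cs.simple '' K) : Set W) := by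
  refine ⟨_, rfl, ?_⟩
  have hsq : ℓIi * ℓIi = 1 := cs.mul_self_eq_one_of_forall_length_le hℓIimem hℓIimax
  have hinv : ℓIi⁻¹ = ℓIi := inv_eq_of_mul_eq_one_left hsq
  have hmem {j : Δ} (hj : j ∈ I ∪ {i}) : ι j ∈ I ∪ {i} := by
    rw [← cs.simple_mem_closure_iff, ← hι j hj]
    exact mul_mem (mul_mem hℓIimem (Subgroup.subset_closure ⟨j, hj, rfl⟩)) (inv_mem hℓIimem)
  have hιι {j : Δ} (hj : j ∈ I ∪ {i}) : ι (ι j) = j := by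
    apply cs.simple_injective
    rw [← hι _ (hmem hj), ← hι j hj, hinv, mul_assoc, mul_assoc, mul_assoc, hsq,
      mul_one, ← mul_assoc, hsq, one_mul]
  have hiJ : i ∈ I ∪ {i} := Or.inr rfl
  have hK : ι '' I = (I ∪ {i}) \ {ι i} := by
    ext k
    constructor
    · rintro ⟨j, hj, rfl⟩
      refine ⟨hmem (Or.inl hj), fun h => hi ?_⟩
      rwa [← hιι hiJ, ← Set.mem_singleton_iff.mp h, hιι (Or.inl hj)]
    · rintro ⟨hk, hki⟩
      refine ⟨ι k, (hmem hk).resolve_right fun h => hki ?_, hιι hk⟩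
      rw [Set.mem_singleton_iff, ← Set.mem_singleton_iff.mp h, hιι hk]
  have himage : MulAut.conj ℓIi '' (cs.simple '' I) = cs.simple '' (ι '' I) := by
    rw [Set.image_image, Set.image_image]
    exact Set.image_congr fun j hj => hι j (Or.inl hj)
  have hconj : Subgroup.closure (cs.simple '' ((I ∪ {i}) \ {ι i})) =
      (Subgroup.closure (cs.simple '' I)).map (MulAut.conj ℓIi).toMonoidHom := by
    rw [MonoidHom.map_closure, ← hK, ← himage]
    rfl
  rw [hconj]
  ext x
  constructor
  · rintro ⟨a, ha, rfl⟩
    refine ⟨_, ⟨ℓI⁻¹ * a * ℓI, mul_mem (mul_mem (inv_mem hℓImem) ha) hℓImem, rfl⟩, ?_⟩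
    simp only [MulEquiv.toMonoidHom_eq_coe, MonoidHom.coe_coe, MulAut.conj_apply]
    rw [hinv]
    simp only [mul_assoc]
    rw [← mul_assoc ℓIi ℓIi, hsq, one_mul, mul_inv_cancel_left]
  · rintro ⟨_, ⟨a, ha, rfl⟩, rfl⟩
    refine ⟨ℓI * a * ℓI⁻¹, mul_mem (mul_mem hℓImem ha) (inv_mem hℓImem), ?_⟩
    simp only [MulEquiv.toMonoidHom_eq_coe, MonoidHom.coe_coe, MulAut.conj_apply]
    rw [hinv]
    simp only [mul_assoc, inv_mul_cancel_left]
    rw [← mul_assoc ℓIi ℓIi, hsq, one_mul]
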